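/- arXiv:1608.06790 — 2 statements merged into one kernel-verified Lean document; each statement's English description precedes it below -/
import Mathlib

section
/- For harmonic polynomials the Fischer inner product is given by a real Gaussian integral: if P and Q are polynomials in m real variables with complex coefficients which are harmonic (i.e. Σ_{j=1}^m ∂²P/∂x_j² = 0 and Σ_{j=1}^m ∂²Q/∂x_j² = 0 as polynomials), then Σ_α α! · \overline{p_α} · q_α = (2π)^{-m/2} ∫_{ℝ^m} \overline{P(x)} Q(x) e^{−|x|²/2} dx, where p_α, q_α are the coefficients of P and Q and α! = α₁!⋯α_m!. -/
open MeasureTheory MvPolynomial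

/-- Polynomial Laplacian. -/
noncomputable def fhgLap {m : ℕ} (P : MvPolynomial (Fin m) ℂ) : MvPolynomial (Fin m) ℂ :=
  ∑ j, pderiv j (pderiv j P)

lemma fhg_pderiv_comm {m : ℕ} (i j : Fin m) (P : MvPolynomial (Fin m) ℂ) :
    pderiv i (pderiv j P) = pderiv j (pderiv i P) := by
  ext a
  rcases eq_or_ne i j with rfl | h
  · rfl
  · simp only [coeff_pderiv, Finsupp.add_apply, Finsupp.single_eq_of_ne h,
      Finsupp.single_eq_of_ne h.symm, add_zero]
    rw [add_right_comm]
    ring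

lemma fhg_lap_pderiv {m : ℕ} (j : Fin m) (P : MvPolynomial (Fin m) ℂ) (h : fhgLap P = 0) :
    fhgLap (pderiv j P) = 0 := by
  have : fhgLap (pderiv j P) = pderiv j (fhgLap P) := by
    simp only [fhgLap, map_sum]
    refine Finset.sum_congr rfl fun i _ => ?_
    rw [fhg_pderiv_comm i j P, fhg_pderiv_comm i j]
  rw [this, h, map_zero]

lemma fhg_hc_pderiv {m : ℕ} (i : Fin m) (k : ℕ) (P : MvPolynomial (Fin m) ℂ) :
    pderiv i (homogeneousComponent (k + 1) P) = homogeneousComponent k (pderiv i P) := by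
  ext a
  simp only [coeff_pderiv, coeff_homogeneousComponent, map_add,
    Finsupp.degree_single, add_left_inj]
  split_ifs <;> simp

lemma fhg_hc_pderiv_zero {m : ℕ} (i : Fin m) (P : MvPolynomial (Fin m) ℂ) :
    pderiv i (homogeneousComponent 0 P) = 0 := by
  rw [homogeneousComponent_zero, pderiv_C]

lemma fhg_lap_hc {m : ℕ} (k : ℕ) (P : MvPolynomial (Fin m) ℂ) (h : fhgLap P = 0) :
    fhgLap (homogeneousComponent k P) = 0 := by
  match k with
  | 0 => simp only [fhgLap, fhg_hc_pderiv_zero, map_zero, Finset.sum_const_zero]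
  | 1 => simp only [fhgLap, fhg_hc_pderiv _ 0, fhg_hc_pderiv_zero, Finset.sum_const_zero]
  | k + 2 =>
    simp only [fhgLap, fhg_hc_pderiv]
    rw [← map_sum]
    exact (congrArg _ h).trans (map_zero _)

lemma fhg_rec {m : ℕ} (L : MvPolynomial (Fin m) ℂ →ₗ[ℂ] ℂ)
    (hL : ∀ j f, L (X j * f) = L (pderiv j f))
    (k : ℕ) (P Q : MvPolynomial (Fin m) ℂ) (hk : P.IsHomogeneous k)
    (hP : fhgLap P = 0) :
    (k : ℂ) * L (P * Q) = ∑ j, L (pderiv j P * pderiv j Q) := by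
  have h1 : (k : ℂ) * L (P * Q) = L ((∑ j, X j * pderiv j P) * Q) := by
    rw [hk.sum_X_mul_pderiv, smul_mul_assoc, map_nsmul, nsmul_eq_mul]
  have h2 : ∑ j, L (pderiv j (pderiv j P) * Q) = 0 := by
    rw [← map_sum, ← Finset.sum_mul]
    rw [show ∑ j, pderiv j (pderiv j P) = 0 from hP, zero_mul, map_zero]
  rw [h1, Finset.sum_mul, map_sum, ← zero_add (∑ j, L (pderiv j P * pderiv j Q)), ← h2,
    ← Finset.sum_add_distrib]
  refine Finset.sum_congr rfl fun j _ => ?_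
  rw [mul_assoc, hL, pderiv_mul, map_add]

lemma fhg_const {m : ℕ} (L : MvPolynomial (Fin m) ℂ →ₗ[ℂ] ℂ)
    (hL : ∀ j f, L (X j * f) = L (pderiv j f))
    (Q : MvPolynomial (Fin m) ℂ) (hQ : fhgLap Q = 0) :
    L Q = coeff 0 Q * L 1 := by
  conv_lhs => rw [← sum_homogeneousComponent Q]
  rw [map_sum, Finset.sum_eq_single 0]
  · rw [homogeneousComponent_zero, C_eq_smul_one, map_smul, smul_eq_mul]
  · intro k _ hk
    have := fhg_rec L hL k (homogeneousComponent k Q) 1 (homogeneousComponent_isHomogeneous k Q)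
      (fhg_lap_hc k Q hQ)
    simpa [hk] using this
  · simp

lemma fhg_homog {m : ℕ} (L : MvPolynomial (Fin m) ℂ →ₗ[ℂ] ℂ)
    (hL : ∀ j f, L (X j * f) = L (pderiv j f))
    (F : MvPolynomial (Fin m) ℂ → MvPolynomial (Fin m) ℂ →ₗ[ℂ] ℂ)
    (hF : ∀ Q j f, F Q (X j * f) = F (pderiv j Q) f) (hF1 : ∀ Q, F Q 1 = coeff 0 Q)
    (k : ℕ) : ∀ (P Q : MvPolynomial (Fin m) ℂ), P.IsHomogeneous k →
    fhgLap P = 0 → fhgLap Q = 0 → L (P * Q) = F Q P * L 1 := by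
  induction k with
  | zero =>
    intro P Q hk hP hQ
    rw [← totalDegree_zero_iff_isHomogeneous, totalDegree_eq_zero_iff_eq_C] at hk
    rw [hk, C_mul', map_smul, C_eq_smul_one, map_smul, hF1, fhg_const L hL Q hQ]
    simp [mul_assoc]
  | succ k ih =>
    intro P Q hk hP hQ
    have h1 := fhg_rec L hL (k + 1) P Q hk hP
    have h2 : ((k + 1 : ℕ) : ℂ) * F Q P = ∑ j, F (pderiv j Q) (pderiv j P) := by
      have : ((k + 1 : ℕ) : ℂ) * F Q P = F Q (∑ j, X j * pderiv j P) := by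
        rw [hk.sum_X_mul_pderiv, map_nsmul, nsmul_eq_mul]
      rw [this, map_sum]
      exact Finset.sum_congr rfl fun j _ => hF _ _ _
    have h3 : ((k + 1 : ℕ) : ℂ) ≠ 0 := Nat.cast_ne_zero.2 (Nat.succ_ne_zero k)
    apply mul_left_cancel₀ h3
    rw [h1, ← mul_assoc, h2, Finset.sum_mul]
    exact Finset.sum_congr rfl fun j _ => ih _ _ hk.pderiv (fhg_lap_pderiv j P hP)
      (fhg_lap_pderiv j Q hQ)

lemma fhg_alg {m : ℕ} (L : MvPolynomial (Fin m) ℂ →ₗ[ℂ] ℂ)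
    (hL : ∀ j f, L (X j * f) = L (pderiv j f))
    (F : MvPolynomial (Fin m) ℂ → MvPolynomial (Fin m) ℂ →ₗ[ℂ] ℂ)
    (hF : ∀ Q j f, F Q (X j * f) = F (pderiv j Q) f) (hF1 : ∀ Q, F Q 1 = coeff 0 Q)
    (P Q : MvPolynomial (Fin m) ℂ)
    (hP : fhgLap P = 0) (hQ : fhgLap Q = 0) : L (P * Q) = F Q P * L 1 := by
  rw [← sum_homogeneousComponent P, Finset.sum_mul, map_sum, map_sum, Finset.sum_mul]
  exact Finset.sum_congr rfl fun k _ => fhg_homog L hL F hF hF1 k _ Q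
    (homogeneousComponent_isHomogeneous k P) (fhg_lap_hc k P hP) hQ

/-- The Fischer form. -/
noncomputable def fhgF {m : ℕ} (Q : MvPolynomial (Fin m) ℂ) : MvPolynomial (Fin m) ℂ →ₗ[ℂ] ℂ :=
  (basisMonomials (Fin m) ℂ).constr ℂ
    fun a => ((∏ j, Nat.factorial (a j) : ℕ) : ℂ) * coeff a Q

lemma fhgF_monomial {m : ℕ} (Q : MvPolynomial (Fin m) ℂ) (a : Fin m →₀ ℕ) (c : ℂ) :
    fhgF Q (monomial a c) = c * (((∏ j, Nat.factorial (a j) : ℕ) : ℂ) * coeff a Q) := by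
  have h := (basisMonomials (Fin m) ℂ).constr_basis ℂ
    (fun a => ((∏ j, Nat.factorial (a j) : ℕ) : ℂ) * coeff a Q) a
  rw [coe_basisMonomials] at h
  have hc : monomial a c = c • monomial a (1 : ℂ) := by rw [smul_monomial, smul_eq_mul, mul_one]
  rw [hc, map_smul, smul_eq_mul]
  exact congrArg (c * ·) h

lemma fhgF_one {m : ℕ} (Q : MvPolynomial (Fin m) ℂ) : fhgF Q 1 = coeff 0 Q := by
  have := fhgF_monomial Q 0 1
  simpa using this

lemma fhgF_X {m : ℕ} (Q : MvPolynomial (Fin m) ℂ) (j : Fin m) (f : MvPolynomial (Fin m) ℂ) :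
    fhgF Q (X j * f) = fhgF (pderiv j Q) f := by
  induction f using MvPolynomial.induction_on' with
  | add p q hp hq => rw [mul_add, map_add, map_add, hp, hq]
  | monomial a c =>
    have hX : X j * monomial a c = monomial (a + Finsupp.single j 1) c := by
      rw [X, monomial_mul, one_mul, add_comm]
    have hfac : (∏ i, Nat.factorial ((a + Finsupp.single j 1 : Fin m →₀ ℕ) i)) =
        (a j + 1) * ∏ i, Nat.factorial (a i) := by
      rw [Fintype.prod_eq_mul_prod_compl j, Fintype.prod_eq_mul_prod_compl j, ← mul_assoc]
      congr 1
      · simp [Nat.factorial_succ]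
      · refine Finset.prod_congr rfl fun i hi => ?_
        have hij : i ≠ j := by simpa using hi
        simp [hij]
    rw [hX, fhgF_monomial, fhgF_monomial, coeff_pderiv, hfac]
    push_cast
    ring

/-- Moments. -/
noncomputable def fhgM (n : ℕ) : ℂ := ∫ x : ℝ, ((x : ℂ) ^ n * (Real.exp (-x ^ 2 / 2) : ℂ))

lemma fhg_int (n : ℕ) : Integrable (fun x : ℝ => ((x : ℂ) ^ n * (Real.exp (-x ^ 2 / 2) : ℂ))) := by
  have := integrable_rpow_mul_exp_neg_mul_sq (b := 1 / 2) (by norm_num) (s := n)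
    (lt_of_lt_of_le (by norm_num) (Nat.cast_nonneg n))
  refine (this.ofReal (𝕜 := ℂ)).congr (Filter.Eventually.of_forall fun x => ?_)
  simp only [Real.rpow_natCast]
  rw [show -(1 / 2) * x ^ 2 = -x ^ 2 / 2 by ring]
  simp

lemma fhgM_zero : fhgM 0 = (Real.sqrt (2 * Real.pi) : ℂ) := by
  have := integral_gaussian (1 / 2)
  rw [show Real.pi / (1 / 2) = 2 * Real.pi by ring] at this
  rw [← this, ← integral_complex_ofReal, fhgM]
  congr 1
  ext x
  rw [pow_zero, one_mul, show -(1 / 2) * x ^ 2 = -x ^ 2 / 2 by ring]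

lemma fhgM_succ (n : ℕ) : fhgM (n + 1) = n * fhgM (n - 1) := by
  have hd : ∀ x : ℝ, HasDerivAt (fun x : ℝ => ((x : ℂ) ^ n * (Real.exp (-x ^ 2 / 2) : ℂ)))
      (n * ((x : ℂ) ^ (n - 1) * (Real.exp (-x ^ 2 / 2) : ℂ))
        - (x : ℂ) ^ (n + 1) * (Real.exp (-x ^ 2 / 2) : ℂ)) x := by
    intro x
    have h1 : HasDerivAt (fun x : ℝ => x ^ n * Real.exp (-x ^ 2 / 2))
        (n * x ^ (n - 1) * Real.exp (-x ^ 2 / 2) +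
          x ^ n * (Real.exp (-x ^ 2 / 2) * (-(2 * x) / 2))) x := by
      apply (hasDerivAt_pow n x).mul
      apply HasDerivAt.exp
      apply HasDerivAt.div_const
      apply HasDerivAt.fun_neg
      simpa using hasDerivAt_pow 2 x
    have h2 := h1.ofReal_comp
    simp only [Complex.ofReal_mul, Complex.ofReal_pow] at h2
    refine h2.congr_deriv ?_
    push_cast
    ring
  have hi := ((fhg_int (n - 1)).const_mul (n : ℂ)).sub (fhg_int (n + 1))
  have h := integral_eq_zero_of_hasDerivAt_of_integrable hd hi (fhg_int n)
  rw [integral_sub ((fhg_int (n - 1)).const_mul (n : ℂ)) (fhg_int (n + 1)),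
    integral_const_mul] at h
  exact (sub_eq_zero.1 h).symm

/-- Gaussian functional on polynomials. -/
noncomputable def fhgL (m : ℕ) : MvPolynomial (Fin m) ℂ →ₗ[ℂ] ℂ :=
  (basisMonomials (Fin m) ℂ).constr ℂ fun a => ∏ j, fhgM (a j)

lemma fhgL_monomial {m : ℕ} (a : Fin m →₀ ℕ) (c : ℂ) :
    fhgL m (monomial a c) = c * ∏ j, fhgM (a j) := by
  have h := (basisMonomials (Fin m) ℂ).constr_basis ℂ (fun a => ∏ j, fhgM (a j)) a
  rw [coe_basisMonomials] at h
  have hc : monomial a c = c • monomial a (1 : ℂ) := by rw [smul_monomial, smul_eq_mul, mul_one]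
  rw [hc, map_smul, smul_eq_mul]
  exact congrArg (c * ·) h

lemma fhgL_one (m : ℕ) : fhgL m 1 = (Real.sqrt (2 * Real.pi) : ℂ) ^ m := by
  have := fhgL_monomial (m := m) 0 1
  simpa [fhgM_zero] using this

lemma fhgL_X {m : ℕ} (j : Fin m) (f : MvPolynomial (Fin m) ℂ) :
    fhgL m (X j * f) = fhgL m (pderiv j f) := by
  induction f using MvPolynomial.induction_on' with
  | add p q hp hq => rw [mul_add, map_add, map_add, map_add, hp, hq]
  | monomial a c =>
    have hX : X j * monomial a c = monomial (a + Finsupp.single j 1) c := by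
      rw [X, monomial_mul, one_mul, add_comm]
    rw [hX, pderiv_monomial, fhgL_monomial, fhgL_monomial, Fintype.prod_eq_mul_prod_compl j,
      Fintype.prod_eq_mul_prod_compl j, mul_assoc c, ← mul_assoc (a j : ℂ)]
    congr 2
    · simp [fhgM_succ]
    · refine Finset.prod_congr rfl fun i hi => ?_
      have hij : i ≠ j := by simpa using hi
      simp [hij]

lemma fhg_mono_eq {m : ℕ} (a : Fin m →₀ ℕ) (c : ℂ) (x : Fin m → ℝ) :
    eval (fun j => (x j : ℂ)) (monomial a c) * (Real.exp (-(∑ j, x j ^ 2) / 2) : ℂ) =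
      c * ∏ j, ((x j : ℂ) ^ (a j) * (Real.exp (-x j ^ 2 / 2) : ℂ)) := by
  rw [eval_monomial, Finsupp.prod_fintype _ _ (by simp), Finset.prod_mul_distrib, mul_assoc]
  congr 2
  rw [← Complex.ofReal_prod, ← Real.exp_sum, ← Finset.sum_div, Finset.sum_neg_distrib]

lemma fhg_L_int {m : ℕ} (f : MvPolynomial (Fin m) ℂ) :
    Integrable (fun x : Fin m → ℝ =>
      eval (fun j => (x j : ℂ)) f * (Real.exp (-(∑ j, x j ^ 2) / 2) : ℂ)) ∧
    ∫ x : Fin m → ℝ, eval (fun j => (x j : ℂ)) f * (Real.exp (-(∑ j, x j ^ 2) / 2) : ℂ)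
      = fhgL m f := by
  induction f using MvPolynomial.induction_on' with
  | add p q hp hq =>
    simp only [map_add, add_mul]
    exact ⟨hp.1.add hq.1, by rw [integral_add hp.1 hq.1, hp.2, hq.2]⟩
  | monomial a c =>
    simp only [fhg_mono_eq]
    constructor
    · apply Integrable.const_mul
      exact Integrable.fintype_prod
        (f := fun (j : Fin m) (y : ℝ) => ((y : ℂ) ^ (a j) * (Real.exp (-y ^ 2 / 2) : ℂ)))
        (fun j => fhg_int (a j))
    · rw [integral_const_mul, fhgL_monomial, integral_fintype_prod_volume_eq_prod
        (f := fun (j : Fin m) (y : ℝ) => ((y : ℂ) ^ (a j) * (Real.exp (-y ^ 2 / 2) : ℂ)))]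
      rfl

/-- For harmonic polynomials `P`, `Q` in `m` real variables with complex coefficients
(i.e. polynomials annihilated by the Laplacian `∑_j ∂²/∂x_j²`), the Fischer inner product
is given by a real Gaussian integral:
`∑_α α! conj(p_α) q_α = (2π)^{-m/2} ∫_{ℝ^m} conj(P(x)) Q(x) e^{-|x|²/2} dx`.
(The sum over all multi-indices reduces to the sum over `P.support ∪ Q.support`.) -/
theorem fischer_harmonic_gaussian (m : ℕ) (P Q : MvPolynomial (Fin m) ℂ)
    (hP : ∑ j, pderiv j (pderiv j P) = 0) (hQ : ∑ j, pderiv j (pderiv j Q) = 0) :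
    ∑ α ∈ P.support ∪ Q.support,
        ((∏ j, Nat.factorial (α j) : ℕ) : ℂ) * (starRingEnd ℂ (P.coeff α)) * Q.coeff α
    = ((Real.sqrt (2 * Real.pi) ^ m : ℝ) : ℂ)⁻¹ *
        ∫ x : Fin m → ℝ,
          (starRingEnd ℂ (eval (fun j => (x j : ℂ)) P)) * eval (fun j => (x j : ℂ)) Q *
            (Real.exp (-(∑ j, x j ^ 2) / 2) : ℂ) := by
  have hconj : ∀ x : Fin m → ℝ, starRingEnd ℂ (eval (fun j => (x j : ℂ)) P) =
      eval (fun j => (x j : ℂ)) (map (starRingEnd ℂ) P) := by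
    intro x
    rw [← eval₂_id, hom_eval₂, eval_map]
    congr 1
    ext j
    simp
  have hP' : fhgLap (map (starRingEnd ℂ) P) = 0 := by
    have := congrArg (map (starRingEnd ℂ)) hP
    simpa [fhgLap, pderiv_map] using this
  have hc : (Real.sqrt (2 * Real.pi) : ℂ) ^ m ≠ 0 := by
    apply pow_ne_zero
    rw [Complex.ofReal_ne_zero]
    positivity
  simp only [hconj, ← map_mul]
  rw [(fhg_L_int _).2, fhg_alg (fhgL m) fhgL_X fhgF fhgF_X fhgF_one _ Q hP' hQ, fhgL_one,
    Complex.ofReal_pow, mul_comm, mul_assoc, mul_inv_cancel₀ hc, mul_one]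
  conv_rhs => rw [(map (starRingEnd ℂ) P).as_sum, map_sum]
  symm
  rw [support_map_of_injective _ (starRingEnd ℂ).injective]
  apply Finset.sum_subset_zero_on_sdiff Finset.subset_union_left
  · intro a ha
    rw [Finset.mem_sdiff, notMem_support_iff] at ha
    simp [ha.2]
  · intro a _
    rw [fhgF_monomial, coeff_map]
    ring
end

section
/- Fischer decomposition: let m ≥ 2 and k ≥ 1. Every Clifford-valued polynomial map R_k : ℝ^m → Cl_m that is homogeneous of degree k can be written uniquely as R_k(x) = M_k(x) + ι(x)·R_{k−1}(x), where M_k is a monogenic Clifford-valued polynomial map homogeneous of degree k, R_{k−1} is a Clifford-valued polynomial map homogeneous of degree k−1, and ι(x)·R_{k−1}(x) denotes left multiplication in Cl_m by the vector ι(x). Both existence and uniqueness of the pair (M_k, R_{k−1}) hold. -/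
open CliffordAlgebra

/-- The quadratic form `Q(x) = -(x₁² + ⋯ + x_m²)` on `ℝ^m`, whose Clifford algebra is
the real Clifford algebra `Cl_m`. -/
noncomputable def negEuclidQ (m : ℕ) : QuadraticForm ℝ (Fin m → ℝ) :=
  QuadraticMap.weightedSumSquares ℝ (fun _ : Fin m => (-1 : ℝ))

/-- `f : ℝ^m → Cl_m` is a Clifford-valued polynomial map homogeneous of degree `k`:
it is a finite sum `f(x) = ∑_α x^α c_α` with `c_α = 0` unless `|α| = k`. -/
def IsHomogPolyMap (m k : ℕ) (f : (Fin m → ℝ) → CliffordAlgebra (negEuclidQ m)) : Prop :=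
  ∃ c : (Fin m →₀ ℕ) →₀ CliffordAlgebra (negEuclidQ m),
    (∀ α ∈ c.support, (∑ j, α j) = k) ∧
    ∀ x, f x = c.sum fun α a => (∏ j, x j ^ α j) • a

/-- `f : ℝ^m → Cl_m` is (left) monogenic: its partial derivatives `g j = ∂_j f` (characterized
through all `ℝ`-linear functionals on `Cl_m`, which separate points) satisfy
`∑_j ι(ε_j)·(∂_j f)(x) = 0` for all `x`. -/
def IsMonogenic (m : ℕ) (f : (Fin m → ℝ) → CliffordAlgebra (negEuclidQ m)) : Prop :=
  ∃ g : Fin m → (Fin m → ℝ) → CliffordAlgebra (negEuclidQ m),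
    (∀ (j : Fin m) (x : Fin m → ℝ) (φ : CliffordAlgebra (negEuclidQ m) →ₗ[ℝ] ℝ),
      deriv (fun u : ℝ => φ (f (Function.update x j u))) (x j) = φ (g j x)) ∧
    ∀ x : Fin m → ℝ, ∑ j, ι (negEuclidQ m) (Pi.single j 1) * g j x = 0


/-- The span of the homogeneous monomials of degree `k`. -/
noncomputable def homP (m k : ℕ) : Submodule ℝ ((Fin m → ℝ) → CliffordAlgebra (negEuclidQ m)) :=
  Submodule.span ℝ {f | ∃ (α : Fin m →₀ ℕ) (a : CliffordAlgebra (negEuclidQ m)),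
    (∑ j, α j) = k ∧ f = fun x => (∏ j, x j ^ α j) • a}

lemma isHomogPolyMap_iff (m k : ℕ) (f : (Fin m → ℝ) → CliffordAlgebra (negEuclidQ m)) :
    IsHomogPolyMap m k f ↔ f ∈ homP m k := by
  constructor
  · rintro ⟨c, hc, hf⟩
    have : f = ∑ α ∈ c.support, fun x => (∏ j, x j ^ α j) • c α := by
      funext x
      rw [hf x, Finset.sum_apply]
      rfl
    rw [this]
    exact Submodule.sum_mem _ fun α hα => Submodule.subset_span ⟨α, c α, hc α hα, rfl⟩
  · intro h
    refine Submodule.span_induction ?_ ?_ ?_ ?_ h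
    · rintro _ ⟨α, a, hα, rfl⟩
      refine ⟨Finsupp.single α a, ?_, ?_⟩
      · intro β hβ
        have := Finsupp.support_single_subset hβ
        simp only [Finset.mem_singleton] at this
        rw [this, hα]
      · intro x
        rw [Finsupp.sum_single_index]
        simp
    · exact ⟨0, by simp, by simp⟩
    · rintro f g _ _ ⟨c, hc, hf⟩ ⟨d, hd, hg⟩
      classical
      refine ⟨c + d, ?_, ?_⟩
      · intro α hα
        rcases Finset.mem_union.1 (Finsupp.support_add hα) with h | h
        · exact hc α h
        · exact hd α h
      · intro x
        rw [Finsupp.sum_add_index' (by simp) (by simp [smul_add]), Pi.add_apply, hf, hg]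
    · rintro r f _ ⟨c, hc, hf⟩
      refine ⟨r • c, fun α hα => hc α (Finsupp.support_smul hα), ?_⟩
      intro x
      rw [Finsupp.sum_smul_index' (by simp), Pi.smul_apply, hf, Finsupp.smul_sum]
      exact Finsupp.sum_congr fun α _ => smul_comm _ _ _

/-- `g` is the `j`-th partial derivative of `f` (weakly). -/
def HasPD (m : ℕ) (j : Fin m) (f g : (Fin m → ℝ) → CliffordAlgebra (negEuclidQ m)) : Prop :=
  ∀ (x : Fin m → ℝ) (φ : CliffordAlgebra (negEuclidQ m) →ₗ[ℝ] ℝ),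
    HasDerivAt (fun u : ℝ => φ (f (Function.update x j u))) (φ (g x)) (x j)

lemma eq_of_dual {m : ℕ} {a b : CliffordAlgebra (negEuclidQ m)}
    (h : ∀ φ : CliffordAlgebra (negEuclidQ m) →ₗ[ℝ] ℝ, φ a = φ b) : a = b := by
  rw [← sub_eq_zero]
  refine (Module.forall_dual_apply_eq_zero_iff ℝ _).1 fun φ => ?_
  rw [map_sub, h φ, sub_self]

lemma HasPD.unique {m : ℕ} {j : Fin m} {f g g' : (Fin m → ℝ) → CliffordAlgebra (negEuclidQ m)}
    (h : HasPD m j f g) (h' : HasPD m j f g') : g = g' := by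
  funext x
  exact eq_of_dual fun φ => (h x φ).unique (h' x φ)

lemma HasPD.add {m : ℕ} {j : Fin m} {f f' g g' : (Fin m → ℝ) → CliffordAlgebra (negEuclidQ m)}
    (h : HasPD m j f g) (h' : HasPD m j f' g') : HasPD m j (f + f') (g + g') := by
  intro x φ
  simpa [Pi.add_def] using (h x φ).add (h' x φ)

lemma HasPD.smul {m : ℕ} {j : Fin m} {f g : (Fin m → ℝ) → CliffordAlgebra (negEuclidQ m)}
    (r : ℝ) (h : HasPD m j f g) : HasPD m j (r • f) (r • g) := by
  intro x φ
  simpa using (h x φ).const_mul r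

lemma HasPD.zero {m : ℕ} {j : Fin m} : HasPD m j 0 0 := by
  intro x φ
  simpa using hasDerivAt_const (x j) (0 : ℝ)

lemma HasPD.sum {m : ℕ} {j : Fin m} {κ : Type} (s : Finset κ)
    {f g : κ → (Fin m → ℝ) → CliffordAlgebra (negEuclidQ m)}
    (h : ∀ i, HasPD m j (f i) (g i)) : HasPD m j (∑ i ∈ s, f i) (∑ i ∈ s, g i) := by
  classical
  induction s using Finset.induction_on with
  | empty => simpa using HasPD.zero
  | insert a s ha ih => rw [Finset.sum_insert ha, Finset.sum_insert ha]; exact (h a).add ih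

lemma HasPD.const_mul {m : ℕ} {j : Fin m} {f g : (Fin m → ℝ) → CliffordAlgebra (negEuclidQ m)}
    (a : CliffordAlgebra (negEuclidQ m)) (h : HasPD m j f g) :
    HasPD m j (fun x => a * f x) (fun x => a * g x) := by
  intro x φ
  simpa using h x (φ ∘ₗ LinearMap.mulLeft ℝ a)

lemma HasPD.coord_smul {m : ℕ} {j : Fin m} {f g : (Fin m → ℝ) → CliffordAlgebra (negEuclidQ m)}
    (i : Fin m) (h : HasPD m j f g) :
    HasPD m j (fun x => x i • f x) (fun x => (if i = j then f x else 0) + x i • g x) := by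
  intro x φ
  by_cases hij : i = j
  · subst hij
    have := (hasDerivAt_id (x i)).mul (h x φ)
    simp only [id, Function.update_eq_self, one_mul] at this
    simpa [Pi.mul_def] using this
  · have := (h x φ).const_mul (x i)
    simpa [hij, Function.update_of_ne hij] using this

/-- A monomial. -/
noncomputable def monom (m : ℕ) (α : Fin m →₀ ℕ) (a : CliffordAlgebra (negEuclidQ m)) :
    (Fin m → ℝ) → CliffordAlgebra (negEuclidQ m) := fun x => (∏ i, x i ^ α i) • a

lemma hasPD_monomial (m : ℕ) (j : Fin m) (α : Fin m →₀ ℕ) (a : CliffordAlgebra (negEuclidQ m)) :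
    HasPD m j (monom m α a) ((α j : ℝ) • monom m (α - Finsupp.single j 1) a) := by
  classical
  intro x φ
  have key : ∀ β : Fin m →₀ ℕ, ∀ y : Fin m → ℝ, (∏ i, y i ^ β i) =
      y j ^ β j * ∏ i ∈ Finset.univ.erase j, y i ^ β i := fun β y =>
    (Finset.mul_prod_erase _ _ (Finset.mem_univ j)).symm
  have h1 : ∀ u : ℝ, ∏ i ∈ Finset.univ.erase j, (Function.update x j u) i ^ α i =
      ∏ i ∈ Finset.univ.erase j, x i ^ α i := fun u =>
    Finset.prod_congr rfl fun i hi => by rw [Function.update_of_ne (Finset.ne_of_mem_erase hi)]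
  have h2 : ∏ i ∈ Finset.univ.erase j, x i ^ (α - Finsupp.single j 1 : Fin m →₀ ℕ) i =
      ∏ i ∈ Finset.univ.erase j, x i ^ α i :=
    Finset.prod_congr rfl fun i hi => by
      simp [Finsupp.single_apply, (Finset.ne_of_mem_erase hi).symm]
  have h3 := (hasDerivAt_pow (α j) (x j)).mul_const
    ((∏ i ∈ Finset.univ.erase j, x i ^ α i) * φ a)
  have e1 : (fun u : ℝ => φ (monom m α a (Function.update x j u)))
      = fun y => y ^ α j * ((∏ i ∈ Finset.univ.erase j, x i ^ α i) * φ a) := by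
    funext u
    rw [monom, key α, h1, map_smul, smul_eq_mul, Function.update_self, mul_assoc]
  have e2 : φ (((α j : ℝ) • monom m (α - Finsupp.single j 1) a) x)
      = (α j : ℝ) * x j ^ (α j - 1) * ((∏ i ∈ Finset.univ.erase j, x i ^ α i) * φ a) := by
    rw [Pi.smul_apply, map_smul, monom, map_smul, key, h2]
    simp
    ring
  rw [e1, e2]
  exact h3

lemma exists_pd {m k : ℕ} {f : (Fin m → ℝ) → CliffordAlgebra (negEuclidQ m)} (hf : f ∈ homP m k) :
    ∃ g : Fin m → (Fin m → ℝ) → CliffordAlgebra (negEuclidQ m),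
      (∀ j, HasPD m j f (g j)) ∧ (∀ x, ∑ j, x j • g j x = (k : ℝ) • f x) ∧
      (k = 0 → ∀ j, g j = 0) ∧ (∀ k', k = k' + 1 → ∀ j, g j ∈ homP m k') := by
  classical
  refine Submodule.span_induction (p := fun f _ =>
    ∃ g : Fin m → (Fin m → ℝ) → CliffordAlgebra (negEuclidQ m),
      (∀ j, HasPD m j f (g j)) ∧ (∀ x, ∑ j, x j • g j x = (k : ℝ) • f x) ∧
      (k = 0 → ∀ j, g j = 0) ∧ (∀ k', k = k' + 1 → ∀ j, g j ∈ homP m k')) ?_ ?_ ?_ ?_ hf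
  · rintro _ ⟨α, a, hα, rfl⟩
    refine ⟨fun j => (α j : ℝ) • monom m (α - Finsupp.single j 1) a,
      fun j => hasPD_monomial m j α a, ?_, ?_, ?_⟩
    · intro x
      rw [← hα]
      push_cast
      rw [Finset.sum_smul]
      refine Finset.sum_congr rfl fun j _ => ?_
      rw [Pi.smul_apply, monom, smul_smul, smul_smul, smul_smul]
      congr 1
      rcases Nat.eq_zero_or_pos (α j) with h0 | h0
      · simp [h0]
      · have : α = Finsupp.single j 1 + (α - Finsupp.single j 1) := by
          rw [add_tsub_cancel_of_le]
          rw [Finsupp.single_le_iff]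
          exact h0
        have h2 : ∏ i, x i ^ α i = x j * ∏ i, x i ^ (α - Finsupp.single j 1 : Fin m →₀ ℕ) i := by
          conv_lhs => rw [this]
          simp only [Finsupp.add_apply, pow_add, Finset.prod_mul_distrib]
          congr 1
          rw [Finset.prod_eq_single j] <;> simp +contextual [Finsupp.single_apply, eq_comm]
        rw [h2]
        ring
    · intro h0 j
      have : α j = 0 := by
        have := Finset.single_le_sum (f := fun j => α j) (fun i _ => Nat.zero_le _)
          (Finset.mem_univ j)
        omega
      simp [this]
    · intro k' hk' j
      rcases Nat.eq_zero_or_pos (α j) with h0 | h0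
      · simp [h0]
      · refine Submodule.smul_mem _ _ (Submodule.subset_span
          ⟨(α - Finsupp.single j 1 : Fin m →₀ ℕ), a, ?_, rfl⟩)
        have : α = Finsupp.single j 1 + (α - Finsupp.single j 1) := by
          rw [add_tsub_cancel_of_le]
          rw [Finsupp.single_le_iff]
          exact h0
        have h2 : ∑ i, α i = 1 + ∑ i, (α - Finsupp.single j 1 : Fin m →₀ ℕ) i := by
          conv_lhs => rw [this]
          simp only [Finsupp.add_apply, Finset.sum_add_distrib]
          congr 1
          rw [Finset.sum_eq_single j] <;> simp +contextual [Finsupp.single_apply, eq_comm]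
        omega
  · exact ⟨fun _ => 0, fun j => HasPD.zero, by simp, by simp, by simp⟩
  · rintro f f' _ _ ⟨g, h1, h2, h3, h4⟩ ⟨g', h1', h2', h3', h4'⟩
    refine ⟨fun j => g j + g' j, fun j => (h1 j).add (h1' j), ?_, ?_, ?_⟩
    · intro x
      simp only [Pi.add_apply, smul_add, Finset.sum_add_distrib, h2, h2']
    · intro h j
      simp [h3 h j, h3' h j]
    · intro k' h j
      exact Submodule.add_mem _ (h4 k' h j) (h4' k' h j)
  · rintro r f _ ⟨g, h1, h2, h3, h4⟩
    refine ⟨fun j => r • g j, fun j => (h1 j).smul r, ?_, ?_, ?_⟩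
    · intro x
      simp only [Pi.smul_apply]
      rw [smul_comm (k : ℝ), ← h2, Finset.smul_sum]
      exact Finset.sum_congr rfl fun j _ => smul_comm _ _ _
    · intro h j
      simp [h3 h j]
    · intro k' h j
      exact Submodule.smul_mem _ _ (h4 k' h j)

lemma homP_const_mul {m k : ℕ} {f : (Fin m → ℝ) → CliffordAlgebra (negEuclidQ m)}
    (a : CliffordAlgebra (negEuclidQ m)) (hf : f ∈ homP m k) :
    (fun x => a * f x) ∈ homP m k := by
  refine Submodule.span_induction (p := fun f _ => (fun x => a * f x) ∈ homP m k) ?_ ?_ ?_ ?_ hf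
  · rintro _ ⟨α, b, hα, rfl⟩
    exact Submodule.subset_span ⟨α, a * b, hα, by funext x; simp⟩
  · have : (fun x => a * (0 : (Fin m → ℝ) → CliffordAlgebra (negEuclidQ m)) x) = 0 := by
      funext x; simp
    rw [this]
    exact Submodule.zero_mem _
  · intro f g _ _ h1 h2
    simpa only [Pi.add_apply, mul_add, Pi.add_def] using Submodule.add_mem _ h1 h2
  · intro r f _ h
    simpa only [Pi.smul_apply, mul_smul_comm, Pi.smul_def] using Submodule.smul_mem _ r h

lemma homP_coord_smul {m k : ℕ} {f : (Fin m → ℝ) → CliffordAlgebra (negEuclidQ m)}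
    (i : Fin m) (hf : f ∈ homP m k) :
    (fun x => x i • f x) ∈ homP m (k + 1) := by
  classical
  refine Submodule.span_induction
    (p := fun f _ => (fun x : Fin m → ℝ => x i • f x) ∈ homP m (k + 1)) ?_ ?_ ?_ ?_ hf
  · rintro _ ⟨α, b, hα, rfl⟩
    refine Submodule.subset_span ⟨Finsupp.single i 1 + α, b, ?_, ?_⟩
    · simp only [Finsupp.add_apply, Finset.sum_add_distrib, hα]
      rw [add_comm k 1]
      congr 1
      rw [Finset.sum_eq_single i] <;> simp +contextual [Finsupp.single_apply, eq_comm]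
    · funext x
      rw [smul_smul]
      congr 1
      simp only [Finsupp.add_apply, pow_add, Finset.prod_mul_distrib]
      congr 1
      symm
      rw [Finset.prod_eq_single i] <;> simp +contextual [Finsupp.single_apply, eq_comm]
  · have : (fun x => x i • (0 : (Fin m → ℝ) → CliffordAlgebra (negEuclidQ m)) x) = 0 := by
      funext x; simp
    rw [this]
    exact Submodule.zero_mem _
  · intro f g _ _ h1 h2
    simpa only [Pi.add_apply, smul_add, Pi.add_def] using Submodule.add_mem _ h1 h2
  · intro r f _ h
    have := Submodule.smul_mem _ r h
    convert this using 1
    funext x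
    exact smul_comm (x i) r (f x)

/-- Left multiplication by the vector variable. -/
noncomputable def vmul (m : ℕ) : ((Fin m → ℝ) → CliffordAlgebra (negEuclidQ m)) →ₗ[ℝ]
    ((Fin m → ℝ) → CliffordAlgebra (negEuclidQ m)) where
  toFun f := fun x => ι (negEuclidQ m) x * f x
  map_add' f g := by funext x; simp [mul_add]
  map_smul' r f := by funext x; simp

/-- The generators. -/
noncomputable def gen (m : ℕ) (j : Fin m) : CliffordAlgebra (negEuclidQ m) :=
  ι (negEuclidQ m) (Pi.single j 1)

lemma iota_eq (m : ℕ) (x : Fin m → ℝ) : ι (negEuclidQ m) x = ∑ j, x j • gen m j := by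
  conv_lhs => rw [pi_eq_sum_univ' x]
  simp only [map_sum, map_smul, gen]

lemma vmul_eq (m : ℕ) (f : (Fin m → ℝ) → CliffordAlgebra (negEuclidQ m)) :
    vmul m f = ∑ i, fun x => x i • (gen m i * f x) := by
  funext x
  simp [vmul, iota_eq, Finset.sum_mul]

lemma vmul_mem {m k : ℕ} {f : (Fin m → ℝ) → CliffordAlgebra (negEuclidQ m)}
    (hf : f ∈ homP m k) : vmul m f ∈ homP m (k + 1) := by
  rw [vmul_eq]
  exact Submodule.sum_mem _ fun i _ => homP_coord_smul i (homP_const_mul _ hf)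

lemma gen_mul (m : ℕ) (i j : Fin m) :
    gen m j * gen m i = - (gen m i * gen m j) - (if i = j then 2 else 0) := by
  have h := ι_mul_ι_add_swap (Q := negEuclidQ m) (Pi.single j 1) (Pi.single i 1)
  have h2 : QuadraticMap.polar (negEuclidQ m) (Pi.single j 1) (Pi.single i 1) =
      if i = j then (-2 : ℝ) else 0 := by
    simp only [QuadraticMap.polar, negEuclidQ, QuadraticMap.weightedSumSquares_apply,
      ← Finset.sum_sub_distrib]
    rw [Finset.sum_eq_single i]
    · by_cases hij : i = j
      · subst hij
        simp; norm_num
      · simp [Pi.single_apply, hij]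
    · intro b _ hb
      simp [Pi.single_apply, hb]
    · simp
  rw [h2] at h
  rw [gen, gen, eq_sub_iff_add_eq, eq_neg_iff_add_eq_zero, add_right_comm, h]
  split_ifs <;> simp [map_ofNat]

/-- `h` is the Dirac derivative of `f`. -/
def IsD (m : ℕ) (f h : (Fin m → ℝ) → CliffordAlgebra (negEuclidQ m)) : Prop :=
  ∃ g : Fin m → (Fin m → ℝ) → CliffordAlgebra (negEuclidQ m),
    (∀ j, HasPD m j f (g j)) ∧ h = fun x => ∑ j, gen m j * g j x

lemma IsD.unique {m : ℕ} {f h h' : (Fin m → ℝ) → CliffordAlgebra (negEuclidQ m)}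
    (H : IsD m f h) (H' : IsD m f h') : h = h' := by
  obtain ⟨g, h1, rfl⟩ := H
  obtain ⟨g', h1', rfl⟩ := H'
  have : g = g' := funext fun j => (h1 j).unique (h1' j)
  rw [this]

lemma IsD.add {m : ℕ} {f h f' h' : (Fin m → ℝ) → CliffordAlgebra (negEuclidQ m)}
    (H : IsD m f h) (H' : IsD m f' h') : IsD m (f + f') (h + h') := by
  obtain ⟨g, h1, rfl⟩ := H
  obtain ⟨g', h1', rfl⟩ := H'
  refine ⟨fun j => g j + g' j, fun j => (h1 j).add (h1' j), ?_⟩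
  funext x
  simp [mul_add, Finset.sum_add_distrib]

lemma IsD.smul {m : ℕ} {f h : (Fin m → ℝ) → CliffordAlgebra (negEuclidQ m)} (r : ℝ)
    (H : IsD m f h) : IsD m (r • f) (r • h) := by
  obtain ⟨g, h1, rfl⟩ := H
  refine ⟨fun j => r • g j, fun j => (h1 j).smul r, ?_⟩
  funext x
  simp [Finset.smul_sum]

lemma IsD.sub {m : ℕ} {f h f' h' : (Fin m → ℝ) → CliffordAlgebra (negEuclidQ m)}
    (H : IsD m f h) (H' : IsD m f' h') : IsD m (f - f') (h - h') := by
  have := H.add (H'.smul (-1))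
  simpa [sub_eq_add_neg] using this

lemma exists_D {m k : ℕ} {f : (Fin m → ℝ) → CliffordAlgebra (negEuclidQ m)} (hf : f ∈ homP m k) :
    ∃ h, IsD m f h ∧ (k = 0 → h = 0) ∧ (∀ k', k = k' + 1 → h ∈ homP m k') ∧
      IsD m (vmul m f) ((-(m + 2 * k : ℝ)) • f - vmul m h) := by
  obtain ⟨g, h1, h2, h3, h4⟩ := exists_pd hf
  refine ⟨_, ⟨g, h1, rfl⟩, ?_, ?_, ?_⟩
  · intro h0
    funext x
    simp [h3 h0]
  · intro k' hk'
    have : (fun x => ∑ j, gen m j * g j x) = ∑ j, fun x => gen m j * g j x := by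
      funext x; simp
    rw [this]
    exact Submodule.sum_mem _ fun j _ => homP_const_mul _ (h4 k' hk' j)
  · refine ⟨fun j => ∑ i, fun x : Fin m → ℝ => (if i = j then gen m i * f x else 0)
          + x i • (gen m i * g j x), fun j => ?_, ?_⟩
    · rw [vmul_eq]
      exact HasPD.sum Finset.univ fun i => ((h1 j).const_mul (gen m i)).coord_smul i
    · funext x
      have sq : ∀ j, gen m j * gen m j = -1 := by
        intro j
        have := ι_sq_scalar (negEuclidQ m) (Pi.single j 1)
        rw [gen, this]
        have h2 : negEuclidQ m (Pi.single j 1) = -1 := by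
          simp [negEuclidQ, QuadraticMap.weightedSumSquares_apply, Pi.single_apply]
        rw [h2, map_neg, map_one]
      have e1 : ∀ j, gen m j * (∑ i, fun x : Fin m → ℝ => (if i = j then gen m i * f x else 0)
          + x i • (gen m i * g j x)) x
          = - f x - ∑ i, x i • (gen m i * (gen m j * g j x)) - (2 : ℝ) • (x j • g j x) := by
        intro j
        rw [Finset.sum_apply, Finset.sum_add_distrib, mul_add, Finset.sum_ite_eq' Finset.univ j]
        simp only [Finset.mem_univ, if_true]
        rw [← mul_assoc, sq, neg_one_mul, sub_sub, sub_eq_add_neg]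
        congr 1
        have : (2 : ℝ) • (x j • g j x) = ∑ i, if i = j then (2 : ℝ) • (x i • g j x) else 0 := by
          rw [Finset.sum_ite_eq' Finset.univ j]; simp
        rw [this, ← Finset.sum_add_distrib, Finset.mul_sum, ← Finset.sum_neg_distrib]
        refine Finset.sum_congr rfl fun i _ => ?_
        rw [mul_smul_comm, ← mul_assoc, gen_mul m i j, sub_mul, neg_mul, mul_assoc, smul_sub,
          smul_neg, neg_add, sub_eq_add_neg]
        congr 2
        split_ifs
        · rw [smul_comm, ofNat_smul_eq_nsmul, two_smul, two_mul, smul_add]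
        · simp
      rw [Finset.sum_congr rfl fun j _ => e1 j]
      rw [Finset.sum_sub_distrib, Finset.sum_sub_distrib, ← Finset.smul_sum, h2 x]
      simp only [Pi.sub_apply, Pi.smul_apply, vmul, LinearMap.coe_mk, AddHom.coe_mk, iota_eq]
      simp only [Finset.sum_mul, Finset.mul_sum, smul_mul_assoc, Finset.sum_const,
        Finset.card_univ, Fintype.card_fin]
      rw [← Nat.cast_smul_eq_nsmul ℝ]
      module

lemma key {m : ℕ} (hm : 2 ≤ m) (k : ℕ) : ∀ c : ℝ, (0 ≤ c ∨ c < -(m + 2 * k : ℝ)) →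
    (∀ f ∈ homP m k, ∃ g ∈ homP m k, IsD m (vmul m g) (f + c • g)) ∧
    (∀ g ∈ homP m k, IsD m (vmul m g) (c • g) → g = 0) := by
  have hm' : (2 : ℝ) ≤ m := by exact_mod_cast hm
  induction k with
  | zero =>
    intro c hc
    have hb : -(m : ℝ) - c ≠ 0 := by
      rcases hc with h | h
      · linarith
      · have : c < -(m : ℝ) := by simpa using h
        linarith
    have hD : ∀ g ∈ homP m 0, IsD m (vmul m g) ((-(m : ℝ)) • g) := by
      intro g hg
      obtain ⟨h, _, h0, _, h2⟩ := exists_D hg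
      rw [h0 rfl] at h2
      simpa using h2
    constructor
    · intro f hf
      refine ⟨(-(m : ℝ) - c)⁻¹ • f, Submodule.smul_mem _ _ hf, ?_⟩
      convert hD _ (Submodule.smul_mem _ (-(m : ℝ) - c)⁻¹ hf) using 1
      have : f = (-(m : ℝ) - c) • ((-(m : ℝ) - c)⁻¹ • f) := by rw [smul_inv_smul₀ hb]
      nth_rw 1 [this]
      module
    · intro g hg H
      have := H.unique (hD g hg)
      have h2 : (-(m : ℝ) - c) • g = 0 := by
        rw [sub_smul, this, sub_self]
      exact (smul_eq_zero.1 h2).resolve_left hb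
  | succ k ih =>
    intro c hc
    push_cast at hc
    set b : ℝ := -(m + 2 * (k + 1 : ℝ)) - c with hbdef
    have hk0 : (0 : ℝ) ≤ k := Nat.cast_nonneg k
    have hb : b ≠ 0 := by
      rcases hc with h | h
      · apply ne_of_lt; linarith
      · apply ne_of_gt; linarith
    have hb2 : 0 ≤ b ∨ b < -(m + 2 * k : ℝ) := by
      rcases hc with h | h
      · right; linarith
      · left; linarith
    obtain ⟨ihs, ihi⟩ := ih b hb2
    constructor
    · intro f hf
      obtain ⟨Df, hDf, _, hmem, _⟩ := exists_D hf
      obtain ⟨h, hh, hDh⟩ := ihs (-Df) (Submodule.neg_mem _ (hmem k rfl))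
      have hg : b⁻¹ • (f + vmul m h) ∈ homP m (k + 1) :=
        Submodule.smul_mem _ _ (Submodule.add_mem _ hf (vmul_mem hh))
      refine ⟨_, hg, ?_⟩
      obtain ⟨Dg, hDg, _, _, hx⟩ := exists_D hg
      have e := hDg.unique ((hDf.add hDh).smul b⁻¹)
      rw [add_neg_cancel_left, inv_smul_smul₀ hb] at e
      rw [e] at hx
      convert hx using 1
      have e2 : f + vmul m h = b • (b⁻¹ • (f + vmul m h)) := by rw [smul_inv_smul₀ hb]
      have e3 : f = b • (b⁻¹ • (f + vmul m h)) - vmul m h := by rw [← e2]; abel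
      generalize b⁻¹ • (f + vmul m h) = g at e3 ⊢
      rw [e3, hbdef]
      push_cast
      module
    · intro g hg H
      obtain ⟨h, hD, _, hmem, hx⟩ := exists_D hg
      have e := H.unique hx
      have e2 : vmul m h = b • g := by
        have : vmul m h = (-((m : ℝ) + 2 * ((k + 1 : ℕ) : ℝ))) • g - c • g := by
          rw [e]; abel
        rw [this, hbdef]
        push_cast
        module
      have h0 : h = 0 := ihi h (hmem k rfl) (by rw [e2]; exact hD.smul b)
      rw [h0, map_zero] at e2
      exact (smul_eq_zero.1 e2.symm).resolve_left hb

lemma isMonogenic_iff {m k : ℕ} {f : (Fin m → ℝ) → CliffordAlgebra (negEuclidQ m)}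
    (hf : f ∈ homP m k) : IsMonogenic m f ↔ IsD m f 0 := by
  constructor
  · rintro ⟨g, h1, h2⟩
    obtain ⟨g', hg', _⟩ := exists_pd hf
    have : g = g' := by
      funext j x
      exact eq_of_dual fun φ => by rw [← h1 j x φ, (hg' j x φ).deriv]
    subst this
    exact ⟨g, hg', funext fun x => (h2 x).symm⟩
  · rintro ⟨g, h1, h2⟩
    exact ⟨g, fun j x φ => (h1 j x φ).deriv, fun x => (congrFun h2 x).symm⟩

/-- Fischer decomposition: for `m ≥ 2` and `k ≥ 1`, every Clifford-valued polynomial map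
`R_k : ℝ^m → Cl_m` homogeneous of degree `k` can be written uniquely as
`R_k(x) = M_k(x) + ι(x)·R_{k-1}(x)` with `M_k` monogenic homogeneous of degree `k` and
`R_{k-1}` homogeneous of degree `k-1`. -/
theorem fischer_decomposition (m k : ℕ) (hm : 2 ≤ m) (hk : 1 ≤ k)
    (R : (Fin m → ℝ) → CliffordAlgebra (negEuclidQ m)) (hR : IsHomogPolyMap m k R) :
    ∃! MR : ((Fin m → ℝ) → CliffordAlgebra (negEuclidQ m)) ×
        ((Fin m → ℝ) → CliffordAlgebra (negEuclidQ m)),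
      IsHomogPolyMap m k MR.1 ∧ IsMonogenic m MR.1 ∧ IsHomogPolyMap m (k - 1) MR.2 ∧
      ∀ x, R x = MR.1 x + ι (negEuclidQ m) x * MR.2 x := by
  obtain ⟨k, rfl⟩ : ∃ k', k = k' + 1 := ⟨k - 1, by omega⟩
  simp only [Nat.add_sub_cancel]
  rw [isHomogPolyMap_iff] at hR
  obtain ⟨DR, hDR, _, hmem, _⟩ := exists_D hR
  obtain ⟨hs, hi⟩ := key hm k 0 (Or.inl le_rfl)
  obtain ⟨S, hS, hDS⟩ := hs DR (hmem k rfl)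
  rw [zero_smul, add_zero] at hDS
  have hM : R - vmul m S ∈ homP m (k + 1) := Submodule.sub_mem _ hR (vmul_mem hS)
  refine ⟨(R - vmul m S, S), ⟨(isHomogPolyMap_iff _ _ _).2 hM, (isMonogenic_iff hM).2 ?_,
    (isHomogPolyMap_iff _ _ _).2 hS, ?_⟩, ?_⟩
  · simpa using hDR.sub hDS
  · intro x
    simp [vmul]
  · rintro ⟨M', S'⟩ ⟨h1, h2, h3, h4⟩
    simp only at h1 h2 h3 h4
    rw [isHomogPolyMap_iff] at h1 h3
    rw [isMonogenic_iff h1] at h2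
    have e : R = M' + vmul m S' := funext h4
    have hDS' : IsD m (vmul m S') DR := by
      have := hDR.sub h2
      rw [sub_zero] at this
      rwa [e, add_sub_cancel_left] at this
    have h0 : S' - S = 0 := hi _ (Submodule.sub_mem _ h3 hS) (by
      have := hDS'.sub hDS
      rw [map_sub, zero_smul]
      rwa [sub_self] at this)
    have hS' : S' = S := sub_eq_zero.1 h0
    subst hS'
    rw [e, add_sub_cancel_right]
end
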